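/- Fix a constant α > 0. For all pairs (B_1, B_2) of binary trees with n leaves satisfying c(B_1) ≥ αn and c(B_2) ≥ αn, one has (1/n!)·Σ_{s=0}^{⌊n/2⌋} z_{μ(s)} |A(B_1)_{μ(s)}| |A(B_2)_{μ(s)}| = exp(2c(B_1)c(B_2)/n^2) + O(n^{-1}), where μ(s) = 2^s 1^{n−2s}, z_{μ(s)} = 2^s s! (n−2s)!, and the constant implied by the O-term depends only on α. -/

import Mathlib

open scoped Classical

inductive PTree : Type
  | leaf : PTree
  | node : PTree → PTree → PTree
deriving DecidableEq

namespace PTree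

def size : PTree → ℕ
  | leaf => 1
  | node l r => size l + size r

def cherries : PTree → ℕ
  | leaf => 0
  | node leaf leaf => 1
  | node l r => cherries l + cherries r

def height : PTree → ℕ
  | leaf => 0
  | node l r => max (height l) (height r) + 1

def encode : PTree → ℕ
  | leaf => 0
  | node l r => Nat.pair (encode l) (encode r) + 1

def normalize : PTree → PTree
  | leaf => leaf
  | node l r =>
      let l' := normalize l
      let r' := normalize r
      if encode l' ≤ encode r' then node l' r' else node r' l'

def isoFuns : PTree → PTree → List (ℕ → ℕ)
  | leaf, leaf => [fun i => i]
  | node l r, node l' r' =>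
      ((isoFuns l l').flatMap fun g => (isoFuns r r').map fun h =>
        fun i => if i < l.size then g i else h (i - l.size) + l'.size)
      ++
      ((isoFuns l r').flatMap fun g => (isoFuns r l').map fun h =>
        fun i => if i < l.size then g i + l'.size else h (i - l.size))
  | _, _ => []

def planeTrees : ℕ → Finset PTree
  | 0 => ∅
  | 1 => {leaf}
  | n + 2 =>
      (Finset.range (n + 1)).attach.biUnion fun k =>
        ((planeTrees (k.1 + 1)) ×ˢ (planeTrees (n + 1 - k.1))).image
          fun p => node p.1 p.2
  termination_by n => n
  decreasing_by
  · have := Finset.mem_range.mp k.2; omega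
  · omega

def binTrees (n : ℕ) : Finset PTree := (planeTrees n).image normalize

/-- Triples (T, v, S): left plane tree, right plane tree, and a matching `v`
(a permutation of `0, …, n-1`, encoded as the list of its values) matching
leaf `i` of `T` with leaf `v i` of `S`. -/
def Triples (n : ℕ) : Finset (PTree × PTree × List ℕ) :=
  (planeTrees n) ×ˢ ((planeTrees n) ×ˢ (List.range n).permutations.toFinset)

/-- Two triples represent the same tanglegram iff there are isomorphisms of the left
trees and of the right trees compatible with the matchings. -/
def equivTriple (n : ℕ) (t t' : PTree × PTree × List ℕ) : Bool :=
  (isoFuns t.1 t'.1).any fun φ => (isoFuns t.2.1 t'.2.1).any fun ψ =>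
    (List.range n).all fun i => t'.2.2.getD (φ i) 0 == ψ (t.2.2.getD i 0)

/-- The tanglegrams of size `n`: equivalence classes of triples. -/
def tangleClasses (n : ℕ) : Finset (Finset (PTree × PTree × List ℕ)) :=
  (Triples n).image fun t => (Triples n).filter (fun t' => equivTriple n t t' = true)

/-- The number of tanglegrams of size `n`. -/
def numTanglegrams (n : ℕ) : ℕ := (tangleClasses n).card

/-- The probability that a uniformly random tanglegram of size `n` satisfies the
(isomorphism-invariant) property `P` of triples. -/
noncomputable def tangleProb (n : ℕ) (P : PTree × PTree × List ℕ → Prop) : ℝ :=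
  ((tangleClasses n).filter fun c => ∃ t ∈ c, P t).card / numTanglegrams n

/-- The expectation of the statistic `f` of a uniformly random tanglegram of size `n`. -/
noncomputable def tangleExp (n : ℕ) (f : PTree × PTree × List ℕ → ℕ) : ℝ :=
  ∑' k : ℕ, (k : ℝ) * tangleProb n (fun t => f t = k)

end PTree

namespace PTree

/-- The distribution on pairs of binary trees (canonical representatives) induced by
the two halves of a uniformly random tanglegram of size `n`:
probability that the pair of isomorphism classes of the two trees lies in `S`. -/
noncomputable def nuT (n : ℕ) (S : Finset (PTree × PTree)) : ℝ :=
  tangleProb n fun t => (normalize t.1, normalize t.2.1) ∈ S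

/-- The distribution on pairs of binary trees induced by two independent uniformly
random plane binary trees with `n` leaves. -/
noncomputable def nuP (n : ℕ) (S : Finset (PTree × PTree)) : ℝ :=
  (((planeTrees n) ×ˢ (planeTrees n)).filter
      fun p => (normalize p.1, normalize p.2) ∈ S).card / ((planeTrees n).card ^ 2 : ℝ)

/-- The total variation distance between `nuT` and `nuP`. -/
noncomputable def tvDist (n : ℕ) : ℝ :=
  ((binTrees n ×ˢ binTrees n).powerset).sup' (Finset.powerset_nonempty _)
    fun S => |nuT n S - nuP n S|

/-- The number of occurrences of (trees isomorphic to) `B` as a fringe subtree of `T`. -/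
def occ (B : PTree) : PTree → ℕ
  | leaf => if normalize leaf = normalize B then 1 else 0
  | node l r => (if normalize (node l r) = normalize B then 1 else 0) + occ B l + occ B r

/-- The number of generators of the automorphism group of `T`: the number of internal
vertices whose two branches are isomorphic. -/
def gens : PTree → ℕ
  | leaf => 0
  | node l r => (if normalize l = normalize r then 1 else 0) + gens l + gens r

/-- `T` has a root branch isomorphic to `B`. -/
def hasBranch (B : PTree) : PTree → Prop
  | leaf => False
  | node l r => normalize l = normalize B ∨ normalize r = normalize B

/-- The cherries of a plane binary tree whose leaves are numbered from `k` on
(left to right), as pairs of leaf positions. -/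
def cherryList : PTree → ℕ → List (ℕ × ℕ)
  | leaf, _ => []
  | node leaf leaf, k => [(k, k + 1)]
  | node l r, k => cherryList l k ++ cherryList r (k + l.size)

/-- The number of matched cherries: cherries of `T` whose two leaves are matched by `L`
to the two leaves of a cherry of `S`. -/
def matchedCherries (T S : PTree) (L : List ℕ) : ℕ :=
  (cherryList T 0).countP fun p =>
    (cherryList S 0).any fun q =>
      (L.getD p.1 0 == q.1 && L.getD p.2 0 == q.2) ||
      (L.getD p.1 0 == q.2 && L.getD p.2 0 == q.1)

/-- The number of automorphisms of the tanglegram represented by the triple `(T, L, S)`: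
pairs of automorphisms of the two trees compatible with the matching `L`. -/
def tangleAutCount (T S : PTree) (L : List ℕ) : ℕ :=
  ((isoFuns T T).map fun a =>
    (isoFuns S S).countP fun b =>
      (List.range T.size).all fun i => L.getD (a i) 0 == b (L.getD i 0)).sum

/-- The number of automorphisms of `T` whose cycle type is `μ(s) = 2^s 1^(n-2s)`,
i.e. involutions of the leaves moving exactly `2 s` leaves. -/
def autMuCount (T : PTree) (s : ℕ) : ℕ :=
  (isoFuns T T).countP fun f =>
    ((List.range T.size).all fun i => f (f i) == i) &&
    ((List.range T.size).countP fun i => !(f i == i)) == 2 * s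

end PTree

namespace PTree

open Polynomial

/-- The number of `i < n` moved by `f`. -/
def movedCount (n : ℕ) (f : ℕ → ℕ) : ℕ :=
  (List.range n).countP fun i => !(f i == i)

/-- Whether `f` restricts to an involution of `{0, …, n - 1}`. -/
def isInvol (n : ℕ) (f : ℕ → ℕ) : Bool :=
  (List.range n).all fun i => f (f i) == i

/-- The generating polynomial of the involutions in the list `L`, by number of moved points. -/
noncomputable def involPoly (L : List (ℕ → ℕ)) (n : ℕ) : ℕ[X] :=
  (L.map fun f => if isInvol n f = true then X ^ movedCount n f else 0).sum

lemma isInvol_iff (n : ℕ) (f : ℕ → ℕ) : isInvol n f = true ↔ ∀ i < n, f (f i) = i := by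
  simp [isInvol]

lemma coeff_involPoly (L : List (ℕ → ℕ)) (n k : ℕ) :
    (involPoly L n).coeff k = L.countP fun f => isInvol n f && movedCount n f == k := by
  induction L with
  | nil => simp [involPoly]
  | cons f L ih =>
    have : involPoly (f :: L) n =
        (if isInvol n f = true then X ^ movedCount n f else 0) + involPoly L n := by
      simp [involPoly]
    rw [this, coeff_add, ih, List.countP_cons, add_comm]
    congr 1
    by_cases h : isInvol n f = true
    · rw [if_pos h, coeff_X_pow]
      simp [h, eq_comm (a := k)]
    · simp [h]

lemma autMuCount_eq_coeff (T : PTree) (s : ℕ) :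
    autMuCount T s = (involPoly (isoFuns T T) T.size).coeff (2 * s) := by
  rw [coeff_involPoly]; rfl

lemma involPoly_append (L₁ L₂ : List (ℕ → ℕ)) (n : ℕ) :
    involPoly (L₁ ++ L₂) n = involPoly L₁ n + involPoly L₂ n := by
  simp [involPoly]

lemma movedCount_glue (a b : ℕ) (g h : ℕ → ℕ) :
    movedCount (a + b) (fun i => if i < a then g i else h (i - a) + a) =
      movedCount a g + movedCount b h := by
  simp only [movedCount]
  rw [List.range_add, List.countP_append, List.countP_map]
  congr 1
  · apply List.countP_congr
    intro i hi
    simp [List.mem_range.mp hi]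
  · apply List.countP_congr
    intro i hi
    simp [add_comm]

lemma isInvol_glue (a b : ℕ) (g h : ℕ → ℕ) (hg : ∀ i < a, g i < a) :
    isInvol (a + b) (fun i => if i < a then g i else h (i - a) + a) =
      (isInvol a g && isInvol b h) := by
  rw [Bool.eq_iff_iff, Bool.and_eq_true, isInvol_iff, isInvol_iff, isInvol_iff]
  constructor
  · intro H
    refine ⟨fun i hi => ?_, fun i hi => ?_⟩
    · simpa [hi, hg i hi] using H i (by omega)
    · have := H (i + a) (by omega)
      simpa using this
  · rintro ⟨H₁, H₂⟩ i hi
    by_cases hia : i < a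
    · simpa [hia, hg i hia] using H₁ i hia
    · obtain ⟨j, rfl⟩ := Nat.exists_eq_add_of_le' (not_lt.1 hia)
      simpa using H₂ j (by omega)

lemma involPoly_glue (L₁ L₂ : List (ℕ → ℕ)) (a b : ℕ) (hL : ∀ g ∈ L₁, ∀ i < a, g i < a) :
    involPoly (L₁.flatMap fun g => L₂.map fun h =>
        fun i => if i < a then g i else h (i - a) + a) (a + b) =
      involPoly L₁ a * involPoly L₂ b := by
  induction L₁ with
  | nil => simp [involPoly]
  | cons g L₁ ih =>
    have hcons : involPoly (g :: L₁) a =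
        (if isInvol a g = true then X ^ movedCount a g else 0) + involPoly L₁ a := by
      simp [involPoly]
    rw [List.flatMap_cons, involPoly_append, ih fun g hg => hL g (List.mem_cons_of_mem _ hg),
      hcons, add_mul]
    congr 1
    rw [involPoly, involPoly, List.map_map, ← List.sum_map_mul_left]
    congr 1
    refine List.map_congr_left fun h _ => ?_
    simp only [Function.comp, movedCount_glue, isInvol_glue a b g h (hL g List.mem_cons_self)]
    by_cases h₁ : isInvol a g = true <;> by_cases h₂ : isInvol b h = true <;>
      simp [h₁, h₂, pow_add]

lemma involPoly_of_movedCount_eq (L : List (ℕ → ℕ)) (n m : ℕ)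
    (hL : ∀ f ∈ L, movedCount n f = m) :
    ∃ N ≤ L.length, involPoly L n = (N : ℕ[X]) * X ^ m := by
  induction L with
  | nil => exact ⟨0, le_rfl, by simp [involPoly]⟩
  | cons f L ih =>
    obtain ⟨N, hN, h⟩ := ih fun f hf => hL f (List.mem_cons_of_mem _ hf)
    have hcons : involPoly (f :: L) n =
        (if isInvol n f = true then X ^ movedCount n f else 0) + involPoly L n := by
      simp [involPoly]
    rw [hcons, h, hL f List.mem_cons_self]
    by_cases hf : isInvol n f = true
    · exact ⟨N + 1, by simpa using hN, by rw [if_pos hf]; push_cast; ring⟩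
    · exact ⟨N, by simp; omega, by simp [hf]⟩

lemma size_pos (T : PTree) : 0 < T.size := by
  induction T with
  | leaf => simp [size]
  | node l r hl hr => simp [size]; omega

lemma isoFuns_spec (T S : PTree) :
    ∀ f ∈ isoFuns T S, T.size = S.size ∧ ∀ i < T.size, f i < S.size := by
  induction T generalizing S with
  | leaf =>
    cases S with
    | leaf => simp [isoFuns]
    | node l' r' => simp [isoFuns]
  | node l r ihl ihr =>
    cases S with
    | leaf => simp [isoFuns]
    | node l' r' =>
      intro f hf
      simp only [isoFuns, List.mem_append, List.mem_flatMap, List.mem_map] at hf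
      simp only [size]
      rcases hf with ⟨g, hg, h, hh, rfl⟩ | ⟨g, hg, h, hh, rfl⟩
      · obtain ⟨e₁, b₁⟩ := ihl _ g hg
        obtain ⟨e₂, b₂⟩ := ihr _ h hh
        refine ⟨by omega, fun i hi => ?_⟩
        by_cases hil : i < l.size
        · have := b₁ i hil
          simp only [hil, if_true]; omega
        · have := b₂ (i - l.size) (by omega)
          simp only [hil, if_false]; omega
      · obtain ⟨e₁, b₁⟩ := ihl _ g hg
        obtain ⟨e₂, b₂⟩ := ihr _ h hh
        refine ⟨by omega, fun i hi => ?_⟩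
        by_cases hil : i < l.size
        · have := b₁ i hil
          simp only [hil, if_true]; omega
        · have := b₂ (i - l.size) (by omega)
          simp only [hil, if_false]; omega

lemma length_flatMap_map {α β γ : Type*} (L₁ : List α) (L₂ : List β) (F : α → β → γ) :
    (L₁.flatMap fun g => L₂.map (F g)).length = L₁.length * L₂.length := by
  simp [List.length_flatMap]

lemma length_isoFuns_le (T S : PTree) : (isoFuns T S).length ≤ 2 ^ (T.size - 1) := by
  induction T generalizing S with
  | leaf => cases S <;> simp [isoFuns, size]
  | node l r ihl ihr =>
    cases S with
    | leaf => simp [isoFuns]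
    | node l' r' =>
      simp only [isoFuns, List.length_append, length_flatMap_map]
      have hl := size_pos l
      have hr := size_pos r
      calc _ ≤ 2 ^ (l.size - 1) * 2 ^ (r.size - 1) + 2 ^ (l.size - 1) * 2 ^ (r.size - 1) :=
            add_le_add (Nat.mul_le_mul (ihl _) (ihr _)) (Nat.mul_le_mul (ihl _) (ihr _))
        _ = 2 ^ ((l.size - 1) + (r.size - 1) + 1) := by ring
        _ = _ := by congr 1; simp only [size]; omega

/-- The generating polynomial of a tree with branches `l` and `r`: an involution either preserves
both branches or interchanges them, in which case it moves every leaf. -/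
lemma involPoly_node (l r : PTree) :
    ∃ N : ℕ, N ≤ 4 ^ (l.size - 1) ∧ (N ≠ 0 → l.size = r.size) ∧
      involPoly (isoFuns (node l r) (node l r)) (node l r).size =
        involPoly (isoFuns l l) l.size * involPoly (isoFuns r r) r.size
          + (N : ℕ[X]) * X ^ (2 * l.size) := by
  simp only [isoFuns, size, involPoly_append]
  rw [involPoly_glue _ _ _ _ fun g hg => (isoFuns_spec _ _ g hg).2]
  by_cases hlr : l.size = r.size
  · obtain ⟨N, hN, h⟩ := involPoly_of_movedCount_eq
      ((isoFuns l r).flatMap fun g => (isoFuns r l).map fun h =>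
        fun i => if i < l.size then g i + l.size else h (i - l.size))
      (l.size + r.size) (2 * l.size) (by
        intro f hf
        simp only [List.mem_flatMap, List.mem_map] at hf
        obtain ⟨g, hg, h, hh, rfl⟩ := hf
        rw [movedCount, List.countP_eq_length.2, List.length_range]
        · omega
        · intro i hi
          rw [List.mem_range] at hi
          by_cases hil : i < l.size
          · simp [hil]; omega
          · have := (isoFuns_spec _ _ h hh).2 (i - l.size) (by omega)
            simp [hil]; omega)
    refine ⟨N, hN.trans ?_, fun _ => hlr, by rw [h]⟩
    rw [length_flatMap_map]
    calc _ ≤ 2 ^ (l.size - 1) * 2 ^ (r.size - 1) :=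
          Nat.mul_le_mul (length_isoFuns_le _ _) (length_isoFuns_le _ _)
      _ = _ := by rw [← hlr, ← mul_pow]; norm_num
  · refine ⟨0, by simp, by simp, ?_⟩
    have : isoFuns l r = [] :=
      List.eq_nil_iff_forall_not_mem.2 fun g hg => hlr (isoFuns_spec _ _ g hg).1
    simp [this, involPoly]

lemma involPoly_leaf : involPoly (isoFuns leaf leaf) leaf.size = 1 := by
  simp [isoFuns, involPoly, size, isInvol, movedCount]

lemma involPoly_cherry :
    involPoly (isoFuns (node leaf leaf) (node leaf leaf)) (node leaf leaf).size = 1 + X ^ 2 := by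
  simp [isoFuns, involPoly, size, isInvol, movedCount, List.range_succ]

lemma cherries_node {l r : PTree} (h : ¬(l = leaf ∧ r = leaf)) :
    (node l r).cherries = l.cherries + r.cherries := by
  cases l <;> cases r <;> simp_all [cherries]

lemma cherries_le_size (T : PTree) : T.cherries ≤ T.size := by
  induction T with
  | leaf => simp [cherries]
  | node l r hl hr =>
    by_cases h : l = leaf ∧ r = leaf
    · obtain ⟨rfl, rfl⟩ := h
      simp [cherries, size]
    · rw [cherries_node h, size]; omega

/-- Interchanging the leaves of an arbitrary set of cherries gives an involution. -/
lemma exists_involPoly_eq (T : PTree) :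
    ∃ E : ℕ[X], involPoly (isoFuns T T) T.size = (1 + X ^ 2) ^ T.cherries + E := by
  induction T with
  | leaf => exact ⟨0, by simp [involPoly_leaf, cherries]⟩
  | node l r hl hr =>
    by_cases h : l = leaf ∧ r = leaf
    · obtain ⟨rfl, rfl⟩ := h
      exact ⟨0, by simp [involPoly_cherry, cherries]⟩
    · obtain ⟨N, -, -, hN⟩ := involPoly_node l r
      obtain ⟨E₁, h₁⟩ := hl
      obtain ⟨E₂, h₂⟩ := hr
      refine ⟨(1 + X ^ 2) ^ l.cherries * E₂ + E₁ * (1 + X ^ 2) ^ r.cherries + E₁ * E₂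
        + (N : ℕ[X]) * X ^ (2 * l.size), ?_⟩
      rw [hN, h₁, h₂, cherries_node h]
      ring

lemma aeval_involPoly_le (T : PTree) {y : ℝ} (hy' : y ^ 2 ≤ 1 / 4) :
    aeval y (involPoly (isoFuns T T) T.size) ≤
      (1 + y ^ 2) ^ T.cherries * Real.exp (4 * (T.size - 1) * y ^ 4) := by
  have hnn : ∀ T : PTree, 0 ≤ aeval y (involPoly (isoFuns T T) T.size) := by
    intro T
    induction T with
    | leaf => simp [involPoly_leaf]
    | node l r hl hr =>
      obtain ⟨N, -, -, hN⟩ := involPoly_node l r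
      rw [hN]
      simp only [map_add, map_mul, map_pow, aeval_X, map_natCast, pow_mul]
      positivity
  induction T with
  | leaf => rw [involPoly_leaf]; simp [cherries, size]
  | node l r hl hr =>
    by_cases h : l = leaf ∧ r = leaf
    · obtain ⟨rfl, rfl⟩ := h
      rw [involPoly_cherry]
      simp only [map_add, map_pow, aeval_X, map_one, cherries, size, pow_one]
      refine le_mul_of_one_le_right (by positivity) (Real.one_le_exp ?_)
      norm_num
      positivity
    · obtain ⟨N, hN4, hN0, hN⟩ := involPoly_node l r
      rw [hN, cherries_node h]
      simp only [map_add, map_mul, map_pow, aeval_X, map_natCast, size]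
      have hNx : (N : ℝ) * y ^ (2 * l.size) ≤ 4 * y ^ 4 := by
        rcases Nat.eq_zero_or_pos N with rfl | hpos
        · simp; positivity
        · have hs := hN0 hpos.ne'
          have h2 : 2 ≤ l.size := by
            by_contra hlt
            have h1 : ∀ T : PTree, T.size < 2 → T = leaf := by
              intro T hT
              cases T with
              | leaf => rfl
              | node a b =>
                have := size_pos a
                have := size_pos b
                simp [size] at hT; omega
            exact h ⟨h1 l (by omega), h1 r (by omega)⟩
          obtain ⟨k, hk⟩ := Nat.exists_eq_add_of_le h2
          have h4 : (N : ℝ) ≤ 4 ^ (k + 1) := by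
            have := hN4
            rw [hk, show 2 + k - 1 = k + 1 by omega] at this
            exact_mod_cast this
          calc (N : ℝ) * y ^ (2 * l.size) ≤ 4 ^ (k + 1) * y ^ (2 * l.size) := by
                gcongr
                rw [pow_mul]; positivity
            _ = 4 * y ^ 4 * (4 * y ^ 2) ^ k := by rw [hk]; ring
            _ ≤ 4 * y ^ 4 :=
                mul_le_of_le_one_right (by positivity)
                  (pow_le_one₀ (by positivity) (by linarith))
      set A := (1 + y ^ 2) ^ l.cherries * Real.exp (4 * (l.size - 1) * y ^ 4)
      set B := (1 + y ^ 2) ^ r.cherries * Real.exp (4 * (r.size - 1) * y ^ 4)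
      have hone : ∀ T : PTree, 1 ≤ (1 + y ^ 2) ^ T.cherries *
          Real.exp (4 * (T.size - 1) * y ^ 4) := by
        intro T
        have : (1 : ℝ) ≤ T.size := by exact_mod_cast size_pos T
        refine one_le_mul_of_one_le_of_one_le
          (one_le_pow₀ (by nlinarith [sq_nonneg y])) (Real.one_le_exp ?_)
        have : 0 ≤ (T.size : ℝ) - 1 := by linarith
        positivity
      have hAB : 1 ≤ A * B := one_le_mul_of_one_le_of_one_le (hone l) (hone r)
      have hexp : 1 + 4 * y ^ 4 ≤ Real.exp (4 * y ^ 4) := by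
        linarith [Real.add_one_le_exp (4 * y ^ 4)]
      calc _ ≤ A * B + 4 * y ^ 4 := by
            refine add_le_add (mul_le_mul hl hr (hnn r) ((hnn l).trans hl)) hNx
        _ ≤ A * B * (1 + 4 * y ^ 4) := by nlinarith [show 0 ≤ y ^ 4 by positivity]
        _ ≤ A * B * Real.exp (4 * y ^ 4) := by gcongr
        _ = _ := by
          simp only [A, B]
          rw [pow_add, show (4 * (((l.size + r.size : ℕ) : ℝ) - 1) * y ^ 4) =
            4 * (l.size - 1) * y ^ 4 + 4 * (r.size - 1) * y ^ 4 + 4 * y ^ 4 by push_cast; ring,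
            Real.exp_add, Real.exp_add]
          ring

lemma coeff_one_add_X_sq_pow (c s : ℕ) : ((1 + X ^ 2 : ℕ[X]) ^ c).coeff (2 * s) = c.choose s := by
  have : (1 + X ^ 2 : ℕ[X]) ^ c = expand ℕ 2 ((1 + X) ^ c) := by simp
  rw [this, mul_comm, coeff_expand_mul (by norm_num), coeff_one_add_X_pow]
  simp

lemma coeff_mul_pow_le_aeval (p : ℕ[X]) (k : ℕ) {y : ℝ} (hy : 0 ≤ y) :
    (p.coeff k : ℝ) * y ^ k ≤ aeval y p := by
  rw [aeval_eq_sum_range]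
  simp only [nsmul_eq_mul]
  by_cases hk : k ≤ p.natDegree
  · exact Finset.single_le_sum (f := fun i => (p.coeff i : ℝ) * y ^ i)
      (fun i _ => by positivity) (Finset.mem_range.2 (by omega))
  · rw [coeff_eq_zero_of_natDegree_lt (by omega)]
    simp only [Nat.cast_zero, zero_mul]
    exact Finset.sum_nonneg fun i _ => by positivity

lemma choose_le_autMuCount (T : PTree) (s : ℕ) : T.cherries.choose s ≤ autMuCount T s := by
  obtain ⟨E, hE⟩ := exists_involPoly_eq T
  rw [autMuCount_eq_coeff, hE, coeff_add, coeff_one_add_X_sq_pow]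
  omega

lemma autMuCount_sub_choose_mul_pow_le (T : PTree) (s : ℕ) {x : ℝ} (hx : 0 ≤ x)
    (hx' : x ≤ 1 / 4) :
    ((autMuCount T s : ℝ) - T.cherries.choose s) * x ^ s ≤
      4 * T.size * x ^ 2 * Real.exp (2 * T.size * x) := by
  obtain ⟨E, hE⟩ := exists_involPoly_eq T
  have hy : Real.sqrt x ^ 2 = x := Real.sq_sqrt hx
  have hle := aeval_involPoly_le T (y := Real.sqrt x) (by rw [hy]; exact hx')
  rw [hE, show 4 = 2 * 2 by rfl, pow_mul, hy] at hle
  simp only [map_add, map_pow, map_one, aeval_X, hy] at hle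
  have hcoeff := coeff_mul_pow_le_aeval E (2 * s) (Real.sqrt_nonneg x)
  rw [pow_mul, hy] at hcoeff
  rw [autMuCount_eq_coeff, hE, coeff_add, coeff_one_add_X_sq_pow]
  push_cast
  rw [add_sub_cancel_left]
  refine hcoeff.trans ?_
  have hn : (1 : ℝ) ≤ T.size := by exact_mod_cast size_pos T
  have hc : (1 + x) ^ T.cherries ≤ Real.exp (T.size * x) := by
    rw [Real.exp_nat_mul]
    calc (1 + x) ^ T.cherries ≤ (1 + x) ^ T.size :=
          pow_le_pow_right₀ (by linarith) (cherries_le_size T)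
      _ ≤ _ := by
          gcongr
          linarith [Real.add_one_le_exp x]
  set u : ℝ := 4 * (T.size - 1) * x ^ 2 with hu
  have hu0 : 0 ≤ u := mul_nonneg (by linarith) (sq_nonneg x)
  have hu1 : u ≤ 4 * T.size * x ^ 2 := by nlinarith [sq_nonneg x]
  have hu2 : u ≤ T.size * x := by nlinarith [mul_nonneg hx (by linarith : (0 : ℝ) ≤ T.size)]
  have hexp : Real.exp u - 1 ≤ u * Real.exp u := by
    have h := Real.add_one_le_exp (-u)
    have h' : Real.exp (-u) * Real.exp u = 1 := by rw [← Real.exp_add]; simp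
    nlinarith [Real.exp_pos u]
  have hexp0 : 0 ≤ Real.exp u - 1 := by linarith [Real.one_le_exp hu0]
  calc aeval (Real.sqrt x) E ≤ (1 + x) ^ T.cherries * (Real.exp u - 1) := by
        rw [mul_sub, mul_one]; linarith
    _ ≤ Real.exp (T.size * x) * (u * Real.exp u) := by gcongr
    _ ≤ Real.exp (T.size * x) * (4 * T.size * x ^ 2 * Real.exp (T.size * x)) := by gcongr
    _ = _ := by
        rw [show 2 * (T.size : ℝ) * x = T.size * x + T.size * x by ring, Real.exp_add]
        ring

end PTree

lemma descFactorial_pow_bound (n m : ℕ) (h : m ≤ n) :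
    (n : ℝ) ^ m * m.factorial ≤ (m : ℝ) ^ m * n.descFactorial m := by
  rw [← Nat.descFactorial_self m, Nat.descFactorial_eq_prod_range, Nat.descFactorial_eq_prod_range]
  push_cast
  rw [← Finset.card_range m, ← Finset.prod_const, ← Finset.prod_const, Finset.card_range,
    ← Finset.prod_mul_distrib, ← Finset.prod_mul_distrib]
  refine Finset.prod_le_prod (fun i _ => by positivity) fun i hi => ?_
  have hi := Finset.mem_range.1 hi
  have hmn : (m : ℝ) ≤ n := by exact_mod_cast h
  have : (0 : ℝ) ≤ i := by positivity
  rw [Nat.cast_sub hi.le, Nat.cast_sub (by omega)]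
  nlinarith

lemma pow_le_exp_mul_descFactorial (n m : ℕ) (h : m ≤ n) :
    (n : ℝ) ^ m ≤ Real.exp m * n.descFactorial m := by
  have h1 := descFactorial_pow_bound n m h
  have h2 := Real.pow_div_factorial_le_exp (m : ℝ) (by positivity) m
  have hf : (0 : ℝ) < m.factorial := by positivity
  rw [div_le_iff₀ hf] at h2
  have h3 : (0 : ℝ) ≤ n.descFactorial m := by positivity
  refine le_of_mul_le_mul_right ?_ hf
  calc _ ≤ _ := h1
    _ ≤ Real.exp m * m.factorial * n.descFactorial m := by gcongr
    _ = _ := by ring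

lemma mul_pow_sub_descFactorial_le (n c s : ℕ) (h : c ≤ n) :
    (n : ℝ) * ((c : ℝ) ^ s - c.descFactorial s) ≤ (s : ℝ) ^ 2 * (n : ℝ) ^ s := by
  induction s with
  | zero => simp
  | succ s ih =>
    have hcn : (c : ℝ) ≤ n := by exact_mod_cast h
    have hdesc : (c.descFactorial (s + 1) : ℝ) = (c - s) * c.descFactorial s := by
      rw [Nat.descFactorial_succ, Nat.cast_mul]
      rcases le_or_gt s c with hs | hs
      · rw [Nat.cast_sub hs]
      · simp [Nat.descFactorial_of_lt hs]
    have hd : (c.descFactorial s : ℝ) ≤ (n : ℝ) ^ s := by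
      exact_mod_cast (Nat.descFactorial_le_pow c s).trans (Nat.pow_le_pow_left h s)
    have hp : (0 : ℝ) ≤ (n : ℝ) ^ s := by positivity
    have hc : (0 : ℝ) ≤ c := by positivity
    have hs0 : (0 : ℝ) ≤ s := by positivity
    have hn0 : (0 : ℝ) ≤ n := by positivity
    calc (n : ℝ) * ((c : ℝ) ^ (s + 1) - c.descFactorial (s + 1))
        = c * (n * ((c : ℝ) ^ s - c.descFactorial s)) + n * (s * c.descFactorial s) := by
          rw [hdesc]; ring
      _ ≤ n * ((s : ℝ) ^ 2 * (n : ℝ) ^ s) + n * (s * (n : ℝ) ^ s) := by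
          refine add_le_add ?_ (by gcongr)
          exact (mul_le_mul_of_nonneg_left ih hc).trans (by gcongr)
      _ ≤ _ := by
          push_cast
          linear_combination mul_nonneg hn0 (mul_nonneg (by linarith : (0 : ℝ) ≤ s + 1) hp)

lemma abs_sub_mul_le {a b g γ δ Q n : ℝ} (hn : 1 ≤ n) (hQ : 1 ≤ Q)
    (hγ : 0 ≤ γ) (hγ' : γ ≤ 1) (hδ : 0 ≤ δ) (hδ' : δ ≤ 1)
    (ha : |a - γ| ≤ Q / n) (hb : |b - δ| ≤ Q / n) (hg : |g - 1| ≤ Q / n) :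
    |a * b * g - γ * δ| ≤ 7 * Q ^ 3 / n := by
  have hQn : Q / n ≤ Q := div_le_self (by linarith) hn
  have hQ0 : 0 ≤ Q / n := by positivity
  have hb' : |b| ≤ 2 * Q := by
    calc |b| = |(b - δ) + δ| := by ring_nf
      _ ≤ |b - δ| + |δ| := abs_add_le _ _
      _ ≤ Q + 1 := by rw [abs_of_nonneg hδ]; linarith
      _ ≤ _ := by linarith
  have hg' : |g| ≤ 2 * Q := by
    calc |g| = |(g - 1) + 1| := by ring_nf
      _ ≤ |g - 1| + |1| := abs_add_le _ _
      _ ≤ Q + 1 := by rw [abs_one]; linarith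
      _ ≤ _ := by linarith
  calc |a * b * g - γ * δ| = |(a - γ) * (b * g) + γ * (b - δ) * g + γ * δ * (g - 1)| := by ring_nf
    _ ≤ |(a - γ) * (b * g)| + |γ * (b - δ) * g| + |γ * δ * (g - 1)| := abs_add_three _ _ _
    _ = |a - γ| * (|b| * |g|) + γ * |b - δ| * |g| + γ * δ * |g - 1| := by
        simp only [abs_mul, abs_of_nonneg hγ, abs_of_nonneg hδ]
    _ ≤ Q / n * (2 * Q * (2 * Q)) + 1 * (Q / n) * (2 * Q) + 1 * 1 * (Q / n) := by gcongr
    _ = Q / n * (4 * Q ^ 2 + 2 * Q + 1) := by ring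
    _ ≤ Q / n * (7 * Q ^ 2) := by gcongr; nlinarith
    _ = _ := by ring

lemma abs_pow_div_descFactorial_sub_one_le (n m : ℕ) (hn : 1 ≤ n) (h : m ≤ n) :
    |(n : ℝ) ^ m / n.descFactorial m - 1| ≤ (m : ℝ) ^ 2 * Real.exp m / n := by
  have hd : (0 : ℝ) < n.descFactorial m := by exact_mod_cast Nat.descFactorial_pos.2 h
  have hn0 : (0 : ℝ) < n := by exact_mod_cast hn
  have h1 := mul_pow_sub_descFactorial_le n n m le_rfl
  have h2 := pow_le_exp_mul_descFactorial n m h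
  have h3 : (n.descFactorial m : ℝ) ≤ (n : ℝ) ^ m := by exact_mod_cast Nat.descFactorial_le_pow n m
  have h4 : (n : ℝ) ^ m / n.descFactorial m - 1 = ((n : ℝ) ^ m - n.descFactorial m) /
      n.descFactorial m := by field_simp
  rw [h4, abs_of_nonneg (div_nonneg (by linarith) hd.le), div_le_div_iff₀ hd hn0]
  calc _ = (n : ℝ) * ((n : ℝ) ^ m - n.descFactorial m) := by ring
    _ ≤ (m : ℝ) ^ 2 * (n : ℝ) ^ m := h1
    _ ≤ (m : ℝ) ^ 2 * (Real.exp m * n.descFactorial m) := by gcongr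
    _ = _ := by ring

namespace PTree

lemma abs_factorial_mul_autMuCount_sub_le (T : PTree) (s : ℕ) (hs : 2 * s ≤ T.size) :
    |(s.factorial : ℝ) * autMuCount T s / (T.size : ℝ) ^ s -
      ((T.cherries : ℝ) / T.size) ^ s| ≤ 4 * Real.exp (4 * s) / T.size := by
  set n := T.size
  have hn : (0 : ℝ) < n := by exact_mod_cast size_pos T
  have hp : (0 : ℝ) < (n : ℝ) ^ s := by positivity
  have hf : (0 : ℝ) < s.factorial := by positivity
  have hch : (s.factorial : ℝ) * T.cherries.choose s = T.cherries.descFactorial s := by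
    exact_mod_cast (Nat.descFactorial_eq_factorial_mul_choose T.cherries s).symm
  have hlow := mul_pow_sub_descFactorial_le n T.cherries s (cherries_le_size T)
  have hdesc : (T.cherries.descFactorial s : ℝ) ≤ (T.cherries : ℝ) ^ s := by
    exact_mod_cast Nat.descFactorial_le_pow T.cherries s
  have hchoose : (T.cherries.choose s : ℝ) ≤ autMuCount T s := by
    exact_mod_cast choose_le_autMuCount T s
  have hsq : (s : ℝ) ^ 2 ≤ Real.exp (2 * s) := by
    rw [show (2 * (s : ℝ)) = s + s by ring, Real.exp_add, sq]
    have := (Real.add_one_le_exp (s : ℝ))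
    gcongr <;> linarith
  have hup : n * (s.factorial * ((autMuCount T s : ℝ) - T.cherries.choose s)) ≤
      Real.exp (4 * s) * (n : ℝ) ^ s := by
    rcases Nat.eq_zero_or_pos s with rfl | hs0
    · have := autMuCount_sub_choose_mul_pow_le T 0 (le_refl (0 : ℝ)) (by norm_num)
      have h1 : (autMuCount T 0 : ℝ) ≤ 1 := by simpa using this
      simpa using (mul_nonpos_of_nonneg_of_nonpos hn.le (sub_nonpos.2 h1)).trans zero_le_one
    · have hs' : (0 : ℝ) < s := by exact_mod_cast hs0
      have hsn : 2 * (s : ℝ) ≤ n := by exact_mod_cast hs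
      have hx : (s : ℝ) / (2 * n) ≤ 1 / 4 := by
        rw [div_le_div_iff₀ (by positivity) (by norm_num)]; linarith
      have := autMuCount_sub_choose_mul_pow_le T s (x := s / (2 * n)) (by positivity) hx
      have hfs : (s.factorial : ℝ) ≤ (s : ℝ) ^ s := by exact_mod_cast Nat.factorial_le_pow s
      have h2 : (2 : ℝ) ^ s ≤ Real.exp s := by
        rw [← Real.exp_one_pow]
        gcongr
        linarith [Real.add_one_le_exp (1 : ℝ)]
      have hR : 4 * (n : ℝ) * (s / (2 * n)) ^ 2 * Real.exp (2 * n * (s / (2 * n))) =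
          s ^ 2 / n * Real.exp s := by
        rw [show 2 * (n : ℝ) * (s / (2 * n)) = s by field_simp]
        field_simp
        norm_num
      rw [hR] at this
      have hd0 : 0 ≤ (autMuCount T s : ℝ) - T.cherries.choose s := by linarith
      calc n * (s.factorial * ((autMuCount T s : ℝ) - T.cherries.choose s))
          ≤ n * ((s : ℝ) ^ s * ((autMuCount T s : ℝ) - T.cherries.choose s)) := by gcongr
        _ = n * (2 ^ s * n ^ s) *
            (((autMuCount T s : ℝ) - T.cherries.choose s) * (s / (2 * n)) ^ s) := by
            rw [div_pow, mul_pow]; field_simp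
        _ ≤ n * (2 ^ s * n ^ s) * (s ^ 2 / n * Real.exp s) := by gcongr
        _ = 2 ^ s * n ^ s * (s ^ 2 * Real.exp s) := by field_simp
        _ ≤ Real.exp s * n ^ s * (Real.exp (2 * s) * Real.exp s) := by gcongr
        _ = _ := by
            rw [show 4 * (s : ℝ) = s + 2 * s + s by ring, Real.exp_add, Real.exp_add]; ring
  have hsq' : (s : ℝ) ^ 2 ≤ Real.exp (4 * s) :=
    hsq.trans (Real.exp_le_exp.2 (by nlinarith [(Nat.cast_nonneg s : (0 : ℝ) ≤ s)]))
  have hsq'' := mul_le_mul_of_nonneg_right hsq' hp.le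
  have hE := mul_pos (Real.exp_pos (4 * s : ℝ)) hp
  rw [div_pow, ← sub_div, abs_div, abs_of_pos hp, div_le_div_iff₀ hp hn, ← abs_of_pos hn,
    ← abs_mul, abs_of_pos hn, abs_le]
  have hfd : 0 ≤ n * (s.factorial * ((autMuCount T s : ℝ) - T.cherries.choose s)) :=
    mul_nonneg hn.le (mul_nonneg hf.le (by linarith))
  have hcd := mul_nonneg hn.le (sub_nonneg.2 hdesc)
  have key : ((s.factorial : ℝ) * autMuCount T s - (T.cherries : ℝ) ^ s) * n =
      n * (s.factorial * ((autMuCount T s : ℝ) - T.cherries.choose s)) -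
        n * ((T.cherries : ℝ) ^ s - T.cherries.descFactorial s) := by
    rw [← hch]; ring
  rw [key]
  constructor <;> linarith

/-- The `s`-th normalised summand differs from the `s`-th term of the exponential series by
`O(1/n)`, with an implied constant that is summable in `s`. -/
lemma abs_summand_sub_le (B₁ B₂ : PTree) (n s : ℕ) (hn : 1 ≤ n) (h₁ : B₁.size = n)
    (h₂ : B₂.size = n) :
    |(if s ∈ Finset.range (n / 2 + 1) then
        (2 : ℝ) ^ s * (Nat.factorial s) * (Nat.factorial (n - 2 * s)) *
            (autMuCount B₁ s) * (autMuCount B₂ s) / (Nat.factorial n : ℝ) else 0)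
        - (2 * B₁.cherries * B₂.cherries / (n : ℝ) ^ 2) ^ s / s.factorial| ≤
      448 / n * ((2 * Real.exp 12) ^ s / s.factorial) := by
  have hn0 : (0 : ℝ) < n := by exact_mod_cast hn
  have hn1 : (1 : ℝ) ≤ n := by exact_mod_cast hn
  have hγ : ((B₁.cherries : ℝ) / n) ^ s ≤ 1 := by
    refine pow_le_one₀ (by positivity) ?_
    rw [div_le_one hn0, ← h₁]
    exact_mod_cast cherries_le_size B₁
  have hδ : ((B₂.cherries : ℝ) / n) ^ s ≤ 1 := by
    refine pow_le_one₀ (by positivity) ?_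
    rw [div_le_one hn0, ← h₂]
    exact_mod_cast cherries_le_size B₂
  have hmain : (2 * B₁.cherries * B₂.cherries / (n : ℝ) ^ 2) ^ s / s.factorial =
      2 ^ s / s.factorial * (((B₁.cherries : ℝ) / n) ^ s * ((B₂.cherries : ℝ) / n) ^ s) := by
    simp only [div_pow, mul_pow, ← pow_mul]
    field_simp
    ring
  have hrhs : 448 / n * ((2 * Real.exp 12) ^ s / s.factorial) =
      2 ^ s / s.factorial * (7 * (4 * Real.exp (4 * s)) ^ 3 / n) := by
    rw [mul_pow, mul_pow, ← Real.exp_nat_mul, ← Real.exp_nat_mul]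
    rw [show ((3 : ℕ) : ℝ) * (4 * s) = s * 12 by push_cast; ring]
    ring
  rw [hmain, hrhs]
  have hexp1 : (1 : ℝ) ≤ Real.exp (4 * s) := Real.one_le_exp (by positivity)
  by_cases hs : 2 * s ≤ n
  · rw [if_pos (Finset.mem_range.2 (by omega))]
    have hd : (0 : ℝ) < n.descFactorial (2 * s) := by exact_mod_cast Nat.descFactorial_pos.2 hs
    have hfac : (n.factorial : ℝ) = (n - 2 * s).factorial * n.descFactorial (2 * s) := by
      exact_mod_cast (Nat.factorial_mul_descFactorial hs).symm
    have hterm : (2 : ℝ) ^ s * (Nat.factorial s) * (Nat.factorial (n - 2 * s)) *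
            (autMuCount B₁ s) * (autMuCount B₂ s) / (Nat.factorial n : ℝ) =
        2 ^ s / s.factorial * (s.factorial * autMuCount B₁ s / (n : ℝ) ^ s *
          (s.factorial * autMuCount B₂ s / (n : ℝ) ^ s) *
            ((n : ℝ) ^ (2 * s) / n.descFactorial (2 * s))) := by
      rw [hfac]
      field_simp
      ring
    rw [hterm, ← mul_sub, abs_mul, abs_of_pos (by positivity : (0 : ℝ) < 2 ^ s / s.factorial)]
    gcongr
    have hA := abs_factorial_mul_autMuCount_sub_le B₁ s (by omega)
    have hB := abs_factorial_mul_autMuCount_sub_le B₂ s (by omega)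
    rw [h₁] at hA
    rw [h₂] at hB
    refine abs_sub_mul_le hn1 (by linarith) (by positivity) hγ (by positivity) hδ hA hB ?_
    refine (abs_pow_div_descFactorial_sub_one_le n (2 * s) hn hs).trans ?_
    have h1 := Real.add_one_le_exp (s : ℝ)
    have h2 : (s : ℝ) ^ 2 ≤ Real.exp (2 * s) := by
      rw [two_mul, Real.exp_add, sq]
      gcongr <;> linarith
    have h3 : Real.exp (4 * s : ℝ) = Real.exp (2 * s) * Real.exp (2 * s) := by
      rw [← Real.exp_add]
      ring_nf
    rw [h3]
    push_cast
    rw [mul_pow, ← mul_assoc]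
    gcongr
    norm_num
  · rw [if_neg (by simp; omega), zero_sub, abs_neg, abs_of_nonneg (by positivity)]
    gcongr
    refine (mul_le_one₀ hγ (by positivity) hδ).trans ?_
    rw [one_le_div hn0]
    have h1 := Real.add_one_le_exp (4 * s : ℝ)
    have h2 : (n : ℝ) ≤ 2 * s := by exact_mod_cast (not_le.1 hs).le
    have h3 : Real.exp (4 * s) ≤ Real.exp (4 * s) ^ 3 := le_self_pow₀ hexp1 (by norm_num)
    rw [mul_pow]
    linarith

end PTree

open PTree in
/-- Lemma 3, part (2): if `c(B₁), c(B₂) ≥ αn`, then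
`(1/n!) ∑_s z_{μ(s)} |A(B₁)_{μ(s)}| |A(B₂)_{μ(s)}| = exp(2c(B₁)c(B₂)/n²) + O(n⁻¹)`,
the `O`-constant depending only on `α`. -/
theorem sum_zmu_autMuCount_eq_exp (α : ℝ) (hα : 0 < α) :
    ∃ C : ℝ, ∀ n : ℕ, 1 ≤ n → ∀ B₁ B₂ : PTree, B₁.size = n → B₂.size = n →
      α * n ≤ B₁.cherries → α * n ≤ B₂.cherries →
      |(∑ s ∈ Finset.range (n / 2 + 1),
          (2 : ℝ) ^ s * (Nat.factorial s) * (Nat.factorial (n - 2 * s)) *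
            (autMuCount B₁ s) * (autMuCount B₂ s)) / (Nat.factorial n : ℝ)
        - Real.exp (2 * B₁.cherries * B₂.cherries / (n : ℝ) ^ 2)| ≤ C / n := by
  refine ⟨448 * Real.exp (2 * Real.exp 12), fun n hn B₁ B₂ h₁ h₂ _ _ => ?_⟩
  have hmajor : HasSum (fun s : ℕ => 448 / (n : ℝ) * ((2 * Real.exp 12) ^ s / s.factorial))
      (448 * Real.exp (2 * Real.exp 12) / n) := by
    have h := (NormedSpace.expSeries_div_hasSum_exp (2 * Real.exp 12)).mul_left (448 / (n : ℝ))
    rw [← Real.exp_eq_exp_ℝ] at h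
    rwa [div_mul_eq_mul_div] at h
  have hexp : HasSum (fun s : ℕ =>
      (2 * B₁.cherries * B₂.cherries / (n : ℝ) ^ 2) ^ s / s.factorial)
      (Real.exp (2 * B₁.cherries * B₂.cherries / (n : ℝ) ^ 2)) := by
    have h := NormedSpace.expSeries_div_hasSum_exp (2 * B₁.cherries * B₂.cherries / (n : ℝ) ^ 2)
    rwa [← Real.exp_eq_exp_ℝ] at h
  have hsum : HasSum (fun s : ℕ => if s ∈ Finset.range (n / 2 + 1) then
        (2 : ℝ) ^ s * (Nat.factorial s) * (Nat.factorial (n - 2 * s)) *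
            (autMuCount B₁ s) * (autMuCount B₂ s) / (Nat.factorial n : ℝ) else 0)
      ((∑ s ∈ Finset.range (n / 2 + 1),
          (2 : ℝ) ^ s * (Nat.factorial s) * (Nat.factorial (n - 2 * s)) *
            (autMuCount B₁ s) * (autMuCount B₂ s)) / (Nat.factorial n : ℝ)) := by
    rw [Finset.sum_div, ← Finset.sum_congr rfl fun s hs => if_pos hs]
    exact hasSum_sum_of_ne_finset_zero fun s hs => if_neg hs
  have hdiff := hsum.sub hexp
  rw [← hdiff.tsum_eq, ← Real.norm_eq_abs]
  exact tsum_of_norm_bounded hmajor fun s => by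
    rw [Real.norm_eq_abs]
    exact abs_summand_sub_le B₁ B₂ n s hn h₁ h₂
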